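/- There exists a constant c > 0 such that for every smooth function ψ : ℝ² → ℝ with ψ(x,z) = 0 for all (x,z) ∈ ∂D, one has sup_{(x,z)∈D} (|∂ₓψ(x,z)| + |∂_zψ(x,z)|) ≤ c · [(∫_D (Δψ)² d(x,z))^{1/2} + (∫_D |∇(Δψ)|² d(x,z))^{1/2}]. -/

import Mathlib

open MeasureTheory

/-- The closed unit square `[0,1] × [0,1]` in `ℝ²`. -/
def unitSq : Set (ℝ × ℝ) := (Set.Icc (0:ℝ) 1) ×ˢ (Set.Icc (0:ℝ) 1)

/-- Partial derivative in the first (`x`) direction. -/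
noncomputable def pdx (f : ℝ × ℝ → ℝ) (p : ℝ × ℝ) : ℝ := fderiv ℝ f p (1, 0)

/-- Partial derivative in the second (`z`) direction. -/
noncomputable def pdz (f : ℝ × ℝ → ℝ) (p : ℝ × ℝ) : ℝ := fderiv ℝ f p (0, 1)

/-- The Jacobian operator `J(g,h) = ∂ₓg ∂_z h − ∂_z g ∂ₓ h`. -/
noncomputable def Jac (g h : ℝ × ℝ → ℝ) (p : ℝ × ℝ) : ℝ :=
  pdx g p * pdz h p - pdz g p * pdx h p

/-- The Laplacian `Δ = ∂ₓₓ + ∂_zz`. -/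
noncomputable def lap (f : ℝ × ℝ → ℝ) (p : ℝ × ℝ) : ℝ := pdx (pdx f) p + pdz (pdz f) p

/-- A continuous function on `[0,1]` vanishing at the endpoints is bounded by any summable
majorant of its sine coefficients. -/
theorem abs_le_tsum_of_sine_coeff_le {g : ℝ → ℝ} (hg : Continuous g) (h0 : g 0 = 0) (h1 : g 1 = 0)
    {b : ℤ → ℝ} (hb : Summable b)
    (hgb : ∀ n : ℤ, |∫ z in (0:ℝ)..1, g z * Real.sin (n * Real.pi * z)| ≤ b n)
    {z : ℝ} (hz : z ∈ Set.Icc (0:ℝ) 1) : |g z| ≤ ∑' n, b n := by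
  have : Fact (0 < (2:ℝ)) := ⟨two_pos⟩
  have hb0 : ∀ n, 0 ≤ b n := fun n => (abs_nonneg _).trans (hgb n)
  rcases eq_or_lt_of_le hz.2 with rfl | hz1
  · rw [h1, abs_zero]
    exact tsum_nonneg hb0
  let h : ℝ → ℂ := fun t => ((g (max t 0) - g (max (-t) 0) : ℝ) : ℂ)
  have hh : Continuous h := by fun_prop
  have hper : h (-1) = h (-1 + 2) := by norm_num [h, h0, h1]
  let F : C(AddCircle (2:ℝ), ℂ) :=
    ⟨AddCircle.liftIco 2 (-1) h, AddCircle.liftIco_continuous hper hh.continuousOn⟩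
  have hcoeff : ∀ n, ‖fourierCoeff F n‖ ≤ b n := by
    intro n
    have hker : ∀ t : ℝ, (fourier (-n) (t : AddCircle (2:ℝ)) : ℂ)
        = Complex.cos ((n * Real.pi * t : ℝ)) - Complex.sin ((n * Real.pi * t : ℝ)) * Complex.I := by
      intro t
      have e : 2 * Real.pi * Complex.I * ((-n : ℤ) : ℂ) * t / (2 : ℝ)
          = -((n * Real.pi * t : ℝ) : ℂ) * Complex.I := by
        push_cast
        ring
      rw [fourier_coe_apply, e, Complex.exp_mul_I, Complex.cos_neg, Complex.sin_neg]
      ring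
    have hint : ∫ t in (-1:ℝ)..1, (fourier (-n) (t : AddCircle (2:ℝ)) : ℂ) • h t
        = ((∫ t in (0:ℝ)..1, g t * Real.sin (n * Real.pi * t) : ℝ) : ℂ) * (-2 * Complex.I) := by
      have hc : Continuous fun t : ℝ => (fourier (-n) (t : AddCircle (2:ℝ)) : ℂ) • h t := by
        simp_rw [hker]
        fun_prop
      rw [← intervalIntegral.integral_add_adjacent_intervals (b := 0)
        (hc.intervalIntegrable _ _) (hc.intervalIntegrable _ _)]
      have hneg : ∫ t in (-1:ℝ)..0, (fourier (-n) (t : AddCircle (2:ℝ)) : ℂ) • h t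
          = ∫ t in (0:ℝ)..1, (fourier (-n) ((-t : ℝ) : AddCircle (2:ℝ)) : ℂ) • h (-t) := by
        rw [intervalIntegral.integral_comp_neg
          (fun t : ℝ => (fourier (-n) (t : AddCircle (2:ℝ)) : ℂ) • h t)]
        simp
      have hc' : Continuous fun t : ℝ =>
          (fourier (-n) ((-t : ℝ) : AddCircle (2:ℝ)) : ℂ) • h (-t) := hc.comp continuous_neg
      rw [hneg, ← intervalIntegral.integral_add (hc'.intervalIntegrable _ _)
        (hc.intervalIntegrable _ _),
        ← intervalIntegral.integral_ofReal, ← intervalIntegral.integral_mul_const]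
      refine intervalIntegral.integral_congr fun t ht => ?_
      rw [Set.uIcc_of_le zero_le_one] at ht
      simp only [hker, h, neg_neg, max_eq_left ht.1, max_eq_right (neg_nonpos.2 ht.1), h0]
      push_cast
      simp only [mul_neg, Complex.cos_neg, Complex.sin_neg, smul_eq_mul]
      ring
    change ‖fourierCoeff (AddCircle.liftIco 2 (-1) h) n‖ ≤ b n
    rw [fourierCoeff_liftIco_eq, fourierCoeffOn_eq_integral]
    have e : (-1:ℝ) + 2 - -1 = 2 := by norm_num
    have e' : (-1:ℝ) + 2 = 1 := by norm_num
    rw [e, e', hint]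
    refine le_trans (le_of_eq ?_) (hgb n)
    simp
    ring
  have hnorm : Summable fun n => ‖fourierCoeff F n‖ :=
    Summable.of_nonneg_of_le (fun _ => norm_nonneg _) hcoeff hb
  have hsum := has_pointwise_sum_fourier_series_of_summable hnorm.of_norm (z : AddCircle (2:ℝ))
  have hFz : F (z : AddCircle (2:ℝ)) = (g z : ℂ) := by
    change AddCircle.liftIco 2 (-1) h (z : AddCircle (2:ℝ)) = _
    rw [AddCircle.liftIco_coe_apply ⟨by linarith [hz.1], by linarith⟩]
    simp [h, max_eq_left hz.1, max_eq_right (neg_nonpos.2 hz.1), h0]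
  have hle := tsum_of_norm_bounded hb.hasSum
    (f := fun i => fourierCoeff F i • fourier i (z : AddCircle (2:ℝ))) fun n => by
      rw [norm_smul, fourier_apply, Circle.norm_coe, mul_one]
      exact hcoeff n
  rw [hsum.tsum_eq, hFz] at hle
  simpa using hle

/-- Cauchy–Schwarz against the constant function on the unit interval. -/
theorem sq_integral_le_integral_sq {G : ℝ → ℝ} (hG : Continuous G) :
    (∫ z in (0:ℝ)..1, G z) ^ 2 ≤ ∫ z in (0:ℝ)..1, G z ^ 2 := by
  set m := ∫ z in (0:ℝ)..1, G z with hm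
  have h : 0 ≤ ∫ z in (0:ℝ)..1, (G z - m) ^ 2 :=
    intervalIntegral.integral_nonneg zero_le_one fun z _ => sq_nonneg _
  have e : ∫ z in (0:ℝ)..1, (G z - m) ^ 2
      = (∫ z in (0:ℝ)..1, G z ^ 2) - 2 * m * (∫ z in (0:ℝ)..1, G z) + m ^ 2 := by
    have : ∀ z, (G z - m) ^ 2 = G z ^ 2 - 2 * m * G z + m ^ 2 := fun z => by ring
    simp_rw [this]
    rw [intervalIntegral.integral_add, intervalIntegral.integral_sub,
      intervalIntegral.integral_const_mul, intervalIntegral.integral_const]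
    · simp
    all_goals exact Continuous.intervalIntegrable (by fun_prop) _ _
  rw [e, ← hm] at h
  nlinarith

/-- Decay of the sine coefficients of a function in `H¹(0,1)`; no boundary condition. -/
theorem sq_sine_coeff_le {f f' : ℝ → ℝ} (hf : ∀ z, HasDerivAt f (f' z) z) (hf' : Continuous f')
    (k : ℝ) :
    k ^ 2 * (∫ z in (0:ℝ)..1, f z * Real.sin (k * z)) ^ 2
      ≤ 8 * ∫ z in (0:ℝ)..1, (f z ^ 2 + f' z ^ 2) := by
  have hfc : Continuous f := continuous_iff_continuousAt.2 fun z => (hf z).continuousAt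
  let G : ℝ → ℝ := fun z => f' z * Real.cos (k * z) - Real.cos k * (f z + z * f' z)
    + f z - (1 - z) * f' z
  have hG : Continuous G := by fun_prop
  have hd : ∀ z, HasDerivAt (fun z => f z * Real.cos (k * z) - Real.cos k * (z * f z)
      - (1 - z) * f z) (G z - k * (f z * Real.sin (k * z))) z := by
    intro z
    have hcos : HasDerivAt (fun z => Real.cos (k * z)) (-Real.sin (k * z) * (k * 1)) z :=
      ((hasDerivAt_id' z).const_mul k).cos
    refine ((((hf z).mul hcos).sub (((hasDerivAt_id' z).mul (hf z)).const_mul (Real.cos k))).sub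
      (((hasDerivAt_id' z).const_sub 1).mul (hf z))).congr_deriv ?_
    simp only [G]
    ring
  have hFTC := intervalIntegral.integral_eq_sub_of_hasDerivAt (a := 0) (b := 1)
    (fun z _ => hd z) (Continuous.intervalIntegrable (by fun_prop) _ _)
  rw [intervalIntegral.integral_sub (hG.intervalIntegrable _ _)
    (Continuous.intervalIntegrable (by fun_prop) _ _),
    intervalIntegral.integral_const_mul] at hFTC
  have heq : k * ∫ z in (0:ℝ)..1, f z * Real.sin (k * z) = ∫ z in (0:ℝ)..1, G z := by
    simp only [mul_one, mul_zero, Real.cos_zero] at hFTC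
    linarith
  rw [← mul_pow, heq, ← intervalIntegral.integral_const_mul]
  refine (sq_integral_le_integral_sq hG).trans ?_
  refine intervalIntegral.integral_mono_on zero_le_one
    (Continuous.intervalIntegrable (by fun_prop) _ _)
    (Continuous.intervalIntegrable (by fun_prop) _ _) fun z hz => ?_
  have hbound : |G z| ≤ 2 * |f z| + 2 * |f' z| := by
    have e : G z = f z * (1 - Real.cos k)
        + f' z * (Real.cos (k * z) - Real.cos k * z - (1 - z)) := by
      simp only [G]
      ring
    rw [e]
    refine (abs_add_le _ _).trans ?_
    rw [abs_mul, abs_mul]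
    have c1 := Real.neg_one_le_cos k
    have c2 := Real.cos_le_one k
    have c3 := Real.neg_one_le_cos (k * z)
    have c4 := Real.cos_le_one (k * z)
    have a1 : |1 - Real.cos k| ≤ 2 := abs_le.2 ⟨by linarith, by linarith⟩
    have a2 : |Real.cos (k * z) - Real.cos k * z - (1 - z)| ≤ 2 :=
      abs_le.2 ⟨by nlinarith [hz.1], by nlinarith [hz.1, hz.2]⟩
    nlinarith [abs_nonneg (f z), abs_nonneg (f' z)]
  have hsq := pow_le_pow_left₀ (abs_nonneg _) hbound 2
  rw [sq_abs] at hsq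
  nlinarith [sq_nonneg (|f z| - |f' z|), sq_abs (f z), sq_abs (f' z)]

/-- A priori bound for the derivative of the solution of `u'' - κ² u = Q` with zero boundary
values on the unit interval. -/
theorem sq_deriv_le_of_dirichlet {u u' u'' : ℝ → ℝ} (hu : ∀ x, HasDerivAt u (u' x) x)
    (hu' : ∀ x, HasDerivAt u' (u'' x) x) (hu'' : Continuous u'') (h0 : u 0 = 0) (h1 : u 1 = 0)
    {κ : ℝ} (hκ : 0 < κ) {x : ℝ} (hx : x ∈ Set.Icc (0:ℝ) 1) :
    κ * u' x ^ 2 ≤ ∫ t in (0:ℝ)..1, (u'' t - κ ^ 2 * u t) ^ 2 := by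
  have hc : Continuous u := continuous_iff_continuousAt.2 fun z => (hu z).continuousAt
  have hc' : Continuous u' := continuous_iff_continuousAt.2 fun z => (hu' z).continuousAt
  have hE : ∫ t in (0:ℝ)..1, (κ ^ 2 * u' t ^ 2 + u'' t ^ 2)
      ≤ ∫ t in (0:ℝ)..1, (u'' t - κ ^ 2 * u t) ^ 2 := by
    have hz : ∫ t in (0:ℝ)..1, (u' t * u' t + u t * u'' t) = 0 := by
      rw [intervalIntegral.integral_eq_sub_of_hasDerivAt (fun t _ => (hu t).mul (hu' t))
        (Continuous.intervalIntegrable (by fun_prop) _ _)]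
      simp [h0, h1]
    have hs : ∫ t in (0:ℝ)..1, (u'' t - κ ^ 2 * u t) ^ 2
        = ∫ t in (0:ℝ)..1, ((u'' t - κ ^ 2 * u t) ^ 2
          + 2 * κ ^ 2 * (u' t * u' t + u t * u'' t)) := by
      rw [intervalIntegral.integral_add, intervalIntegral.integral_const_mul, hz]
      · simp
      all_goals exact Continuous.intervalIntegrable (by fun_prop) _ _
    rw [hs]
    refine intervalIntegral.integral_mono_on zero_le_one
      (Continuous.intervalIntegrable (by fun_prop) _ _)
      (Continuous.intervalIntegrable (by fun_prop) _ _) fun t _ => ?_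
    nlinarith [sq_nonneg (κ * u' t), sq_nonneg (κ ^ 2 * u t)]
  refine le_trans ?_ hE
  obtain ⟨ξ, hξ, hξ0⟩ := exists_hasDerivAt_eq_zero zero_lt_one hc.continuousOn (h0.trans h1.symm)
    fun t _ => hu t
  have hFTC : ∫ t in ξ..x, κ * (u'' t * u' t + u' t * u'' t) = κ * u' x ^ 2 := by
    rw [intervalIntegral.integral_const_mul,
      intervalIntegral.integral_eq_sub_of_hasDerivAt (fun t _ => (hu' t).mul (hu' t))
      (Continuous.intervalIntegrable (by fun_prop) _ _)]
    simp only [Pi.mul_apply, hξ0]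
    ring
  rw [← hFTC]
  refine (le_abs_self _).trans ?_
  rw [← Real.norm_eq_abs]
  refine intervalIntegral.norm_integral_le_integral_norm_uIoc.trans ?_
  have hsub : Set.uIoc ξ x ⊆ Set.Ioc 0 1 := fun t ht =>
    ⟨(le_min hξ.1.le hx.1).trans_lt ht.1, ht.2.trans (max_le hξ.2.le hx.2)⟩
  have hcont : Continuous fun t => κ ^ 2 * u' t ^ 2 + u'' t ^ 2 := by fun_prop
  rw [intervalIntegral.integral_of_le zero_le_one]
  refine (setIntegral_mono_on ?_ ?_ measurableSet_uIoc (g := fun t => κ ^ 2 * u' t ^ 2 + u'' t ^ 2)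
    fun t _ => ?_).trans (setIntegral_mono_set ?_ ?_ hsub.eventuallyLE)
  · exact (Continuous.integrableOn_uIoc (by fun_prop))
  · exact hcont.integrableOn_uIoc
  · rw [Real.norm_eq_abs, abs_le]
    constructor <;> nlinarith [sq_nonneg (κ * u' t + u'' t), sq_nonneg (κ * u' t - u'' t)]
  · exact hcont.integrableOn_Ioc
  · exact Filter.Eventually.of_forall fun t => by positivity

theorem ContDiff.pdx {f : ℝ × ℝ → ℝ} (hf : ContDiff ℝ (⊤ : ℕ∞) f) :
    ContDiff ℝ (⊤ : ℕ∞) (pdx f) :=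
  (hf.fderiv_right (m := (⊤ : ℕ∞)) (by simp)).clm_apply contDiff_const

theorem ContDiff.pdz {f : ℝ × ℝ → ℝ} (hf : ContDiff ℝ (⊤ : ℕ∞) f) :
    ContDiff ℝ (⊤ : ℕ∞) (pdz f) :=
  (hf.fderiv_right (m := (⊤ : ℕ∞)) (by simp)).clm_apply contDiff_const

theorem ContDiff.lap {f : ℝ × ℝ → ℝ} (hf : ContDiff ℝ (⊤ : ℕ∞) f) :
    ContDiff ℝ (⊤ : ℕ∞) (lap f) :=
  hf.pdx.pdx.add hf.pdz.pdz

theorem hasDerivAt_pdx {f : ℝ × ℝ → ℝ} (hf : Differentiable ℝ f) (x z : ℝ) :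
    HasDerivAt (fun t => f (t, z)) (pdx f (x, z)) x :=
  (hf (x, z)).hasFDerivAt.comp_hasDerivAt x ((hasDerivAt_id' x).prodMk (hasDerivAt_const x z))

theorem hasDerivAt_pdz {f : ℝ × ℝ → ℝ} (hf : Differentiable ℝ f) (x z : ℝ) :
    HasDerivAt (fun t => f (x, t)) (pdz f (x, z)) z :=
  (hf (x, z)).hasFDerivAt.comp_hasDerivAt z ((hasDerivAt_const z x).prodMk (hasDerivAt_id' z))

theorem pdx_comp_swap {f : ℝ × ℝ → ℝ} (hf : Differentiable ℝ f) :
    pdx (f ∘ Prod.swap) = pdz f ∘ Prod.swap := by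
  ext ⟨x, z⟩
  have hs : Differentiable ℝ (f ∘ Prod.swap) := hf.comp (by unfold Prod.swap; fun_prop)
  exact (hasDerivAt_pdx hs x z).unique (hasDerivAt_pdz hf z x)

theorem pdz_comp_swap {f : ℝ × ℝ → ℝ} (hf : Differentiable ℝ f) :
    pdz (f ∘ Prod.swap) = pdx f ∘ Prod.swap := by
  ext ⟨x, z⟩
  have hs : Differentiable ℝ (f ∘ Prod.swap) := hf.comp (by unfold Prod.swap; fun_prop)
  exact (hasDerivAt_pdz hs x z).unique (hasDerivAt_pdx hf z x)

theorem lap_comp_swap {f : ℝ × ℝ → ℝ} (hf : ContDiff ℝ (⊤ : ℕ∞) f) :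
    lap (f ∘ Prod.swap) = lap f ∘ Prod.swap := by
  ext p
  rw [lap, pdx_comp_swap (hf.differentiable (by simp)),
    pdz_comp_swap (hf.differentiable (by simp)), pdx_comp_swap (hf.pdz.differentiable (by simp)),
    pdz_comp_swap (hf.pdx.differentiable (by simp))]
  exact add_comm _ _

/-- Differentiation of sine coefficients in the parameter. -/
theorem hasDerivAt_sine_coeff {f : ℝ × ℝ → ℝ} (hf : ContDiff ℝ (⊤ : ℕ∞) f) (k x : ℝ) :
    HasDerivAt (fun x => ∫ z in (0:ℝ)..1, f (x, z) * Real.sin (k * z))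
      (∫ z in (0:ℝ)..1, pdx f (x, z) * Real.sin (k * z)) x := by
  have hc := hf.continuous
  have hc' := hf.pdx.continuous
  obtain ⟨C, hC⟩ := ((isCompact_closedBall x 1).prod
    (isCompact_Icc (a := (0:ℝ)) (b := 1))).exists_bound_of_continuousOn hc'.continuousOn
  refine (intervalIntegral.hasDerivAt_integral_of_dominated_loc_of_deriv_le
    (F := fun x z => f (x, z) * Real.sin (k * z))
    (F' := fun x z => pdx f (x, z) * Real.sin (k * z)) (bound := fun _ => C)
    (Metric.closedBall_mem_nhds x one_pos) ?_ ?_ ?_ ?_ ?_ ?_).2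
  · exact Filter.Eventually.of_forall fun y => Continuous.aestronglyMeasurable (by fun_prop)
  · exact Continuous.intervalIntegrable (by fun_prop) _ _
  · exact Continuous.aestronglyMeasurable (by fun_prop)
  · refine Filter.Eventually.of_forall fun z hz y hy => ?_
    rw [Set.uIoc_of_le zero_le_one] at hz
    rw [norm_mul]
    exact (mul_le_of_le_one_right (norm_nonneg _) (Real.abs_sin_le_one _)).trans
      (hC (y, z) ⟨hy, hz.1.le, hz.2⟩)
  · exact intervalIntegrable_const
  · exact Filter.Eventually.of_forall fun z _ y _ =>
      (hasDerivAt_pdx (hf.differentiable (by simp)) y z).mul_const _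

/-- Two integrations by parts for a sine coefficient. -/
theorem integral_deriv_deriv_mul_sin {g g' g'' : ℝ → ℝ} (hg : ∀ z, HasDerivAt g (g' z) z)
    (hg' : ∀ z, HasDerivAt g' (g'' z) z) (hg'' : Continuous g'') (h0 : g 0 = 0) (h1 : g 1 = 0)
    {k : ℝ} (hk : Real.sin k = 0) :
    ∫ z in (0:ℝ)..1, g'' z * Real.sin (k * z)
      = -k ^ 2 * ∫ z in (0:ℝ)..1, g z * Real.sin (k * z) := by
  have hc : Continuous g := continuous_iff_continuousAt.2 fun z => (hg z).continuousAt
  have hd : ∀ z, HasDerivAt (fun z => g' z * Real.sin (k * z) - k * (g z * Real.cos (k * z)))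
      (g'' z * Real.sin (k * z) + k ^ 2 * (g z * Real.sin (k * z))) z := by
    intro z
    have hcos : HasDerivAt (fun z => Real.cos (k * z)) (-Real.sin (k * z) * (k * 1)) z :=
      ((hasDerivAt_id' z).const_mul k).cos
    have hsin : HasDerivAt (fun z => Real.sin (k * z)) (Real.cos (k * z) * (k * 1)) z :=
      ((hasDerivAt_id' z).const_mul k).sin
    refine (((hg' z).mul hsin).sub (((hg z).mul hcos).const_mul k)).congr_deriv ?_
    ring
  have hFTC := intervalIntegral.integral_eq_sub_of_hasDerivAt (a := 0) (b := 1)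
    (fun z _ => hd z) (Continuous.intervalIntegrable (by fun_prop) _ _)
  rw [intervalIntegral.integral_add (Continuous.intervalIntegrable (by fun_prop) _ _)
    (Continuous.intervalIntegrable (by fun_prop) _ _),
    intervalIntegral.integral_const_mul] at hFTC
  simp only [mul_one, mul_zero, hk, h0, h1, Real.sin_zero, zero_mul, sub_zero] at hFTC
  linarith

theorem setIntegral_unitSq {f : ℝ × ℝ → ℝ} (hf : Continuous f) :
    ∫ p in unitSq, f p = ∫ x in (0:ℝ)..1, ∫ z in (0:ℝ)..1, f (x, z) := by
  rw [unitSq, Measure.volume_eq_prod, setIntegral_prod]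
  · simp only [integral_Icc_eq_integral_Ioc, intervalIntegral.integral_of_le zero_le_one]
  · exact hf.continuousOn.integrableOn_compact (isCompact_Icc.prod isCompact_Icc)

theorem setIntegral_unitSq_comp_swap (f : ℝ × ℝ → ℝ) :
    ∫ p in unitSq, (f ∘ Prod.swap) p = ∫ p in unitSq, f p := by
  rw [unitSq, Measure.volume_eq_prod]
  exact setIntegral_prod_swap _ _ f

theorem mem_frontier_unitSq {p : ℝ × ℝ} :
    p ∈ frontier unitSq ↔ p ∈ unitSq ∧ (p.1 = 0 ∨ p.1 = 1 ∨ p.2 = 0 ∨ p.2 = 1) := by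
  obtain ⟨x, z⟩ := p
  rw [unitSq, frontier_prod_eq, frontier_Icc zero_le_one, closure_Icc]
  simp only [Set.mem_union, Set.mem_prod, Set.mem_insert_iff, Set.mem_singleton_iff]
  constructor
  · rintro (⟨hx, rfl | rfl⟩ | ⟨rfl | rfl, hz⟩) <;> simp_all
  · rintro ⟨⟨hx, hz⟩, h⟩
    tauto

/-- The sine modes in `z` of `∂ₓψ` decay like `k ^ (-3/2)`. -/
theorem sq_sine_coeff_pdx_le {ψ : ℝ × ℝ → ℝ} (hψ : ContDiff ℝ (⊤ : ℕ∞) ψ)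
    (hb : ∀ p ∈ frontier unitSq, ψ p = 0) {k : ℝ} (hk : 0 < k) (hsin : Real.sin k = 0)
    {x : ℝ} (hx : x ∈ Set.Icc (0:ℝ) 1) :
    k ^ 3 * (∫ z in (0:ℝ)..1, pdx ψ (x, z) * Real.sin (k * z)) ^ 2
      ≤ 8 * ∫ p in unitSq, ((lap ψ p) ^ 2 + (pdz (lap ψ) p) ^ 2) := by
  have hd : Differentiable ℝ ψ := hψ.differentiable (by simp)
  have hdz : Differentiable ℝ (pdz ψ) := hψ.pdz.differentiable (by simp)
  have hdl : Differentiable ℝ (lap ψ) := hψ.lap.differentiable (by simp)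
  have c0 := hψ.continuous
  have c1 := hψ.pdx.pdx.continuous
  have c2 := hψ.pdz.pdz.continuous
  have c3 := hψ.lap.continuous
  have c4 := hψ.lap.pdz.continuous
  have hcoef : ∀ {f : ℝ × ℝ → ℝ}, Continuous f →
      Continuous fun t => ∫ z in (0:ℝ)..1, f (t, z) * Real.sin (k * z) := fun hf =>
    intervalIntegral.continuous_parametric_intervalIntegral_of_continuous' (by fun_prop) _ _
  have hends : ∀ a, a = 0 ∨ a = 1 →
      ∫ z in (0:ℝ)..1, ψ (a, z) * Real.sin (k * z) = 0 := by
    intro a ha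
    refine (intervalIntegral.integral_congr (g := fun _ => 0) fun z hz => ?_).trans (by simp)
    rw [Set.uIcc_of_le zero_le_one] at hz
    have : ψ (a, z) = 0 := hb _ (mem_frontier_unitSq.2
      ⟨⟨by rcases ha with rfl | rfl <;> simp, hz⟩, by tauto⟩)
    simp [this]
  have hlap : ∀ t ∈ Set.Icc (0:ℝ) 1, (∫ z in (0:ℝ)..1, pdx (pdx ψ) (t, z) * Real.sin (k * z))
      - k ^ 2 * (∫ z in (0:ℝ)..1, ψ (t, z) * Real.sin (k * z))
      = ∫ z in (0:ℝ)..1, lap ψ (t, z) * Real.sin (k * z) := by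
    intro t ht
    have h := integral_deriv_deriv_mul_sin (hasDerivAt_pdz hd t) (hasDerivAt_pdz hdz t)
      (by fun_prop) (hb (t, 0) (mem_frontier_unitSq.2 ⟨⟨ht, by simp⟩, by simp⟩))
      (hb (t, 1) (mem_frontier_unitSq.2 ⟨⟨ht, by simp⟩, by simp⟩)) hsin
    simp only [lap, add_mul]
    rw [intervalIntegral.integral_add (Continuous.intervalIntegrable (by fun_prop) _ _)
      (Continuous.intervalIntegrable (by fun_prop) _ _), h]
    ring
  have hode := sq_deriv_le_of_dirichlet (hasDerivAt_sine_coeff hψ k)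
    (hasDerivAt_sine_coeff hψ.pdx k)
    (hcoef c1)
    (hends 0 (Or.inl rfl)) (hends 1 (Or.inr rfl)) hk hx
  rw [setIntegral_unitSq (by fun_prop), ← intervalIntegral.integral_const_mul]
  calc _ = k ^ 2 * (k * (∫ z in (0:ℝ)..1, pdx ψ (x, z) * Real.sin (k * z)) ^ 2) := by ring
    _ ≤ k ^ 2 * _ := mul_le_mul_of_nonneg_left hode (sq_nonneg k)
    _ ≤ _ := by
      rw [← intervalIntegral.integral_const_mul]
      refine intervalIntegral.integral_mono_on zero_le_one ?_ ?_ fun t ht => ?_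
      · have d0 := hcoef c0
        have d1 := hcoef c1
        exact Continuous.intervalIntegrable (by fun_prop) _ _
      · exact ((intervalIntegral.continuous_parametric_intervalIntegral_of_continuous'
          (f := fun t z => lap ψ (t, z) ^ 2 + pdz (lap ψ) (t, z) ^ 2)
          (by fun_prop) _ _).const_mul 8).intervalIntegrable _ _
      · rw [hlap t ht]
        exact sq_sine_coeff_le (hasDerivAt_pdz hdl t) (by fun_prop) k

/-- `∂ₓψ` vanishes on the horizontal sides when `ψ` does. -/
theorem pdx_eq_zero_of_side {ψ : ℝ × ℝ → ℝ} (hψ : Differentiable ℝ ψ) {a : ℝ}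
    (ha : ∀ x ∈ Set.Icc (0:ℝ) 1, ψ (x, a) = 0) {x : ℝ} (hx : x ∈ Set.Icc (0:ℝ) 1) :
    pdx ψ (x, a) = 0 := by
  refine (uniqueDiffOn_Icc zero_lt_one x hx).eq_deriv _
    (hasDerivAt_pdx hψ x a).hasDerivWithinAt ?_
  exact (hasDerivWithinAt_const x _ (0:ℝ)).congr ha (ha x hx)

/-- Pointwise bound for `∂ₓψ`, obtained by summing its sine series in `z`. -/
theorem abs_pdx_le {ψ : ℝ × ℝ → ℝ} (hψ : ContDiff ℝ (⊤ : ℕ∞) ψ)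
    (hb : ∀ p ∈ frontier unitSq, ψ p = 0) {p : ℝ × ℝ} (hp : p ∈ unitSq) :
    |pdx ψ p| ≤ (∑' n : ℤ, |(n:ℝ)| ^ (-(3/2) : ℝ)) *
      Real.sqrt (8 * ∫ p in unitSq, ((lap ψ p) ^ 2 + (pdz (lap ψ) p) ^ 2)) := by
  obtain ⟨x, z⟩ := p
  set S := ∫ p in unitSq, ((lap ψ p) ^ 2 + (pdz (lap ψ) p) ^ 2)
  have hd : Differentiable ℝ ψ := hψ.differentiable (by simp)
  have hc := hψ.pdx.continuous
  rw [← tsum_mul_right]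
  refine abs_le_tsum_of_sine_coeff_le (g := fun z => pdx ψ (x, z)) (by fun_prop)
    (pdx_eq_zero_of_side hd (fun t ht => hb _ (mem_frontier_unitSq.2 ⟨⟨ht, by simp⟩, by simp⟩)) hp.1)
    (pdx_eq_zero_of_side hd (fun t ht => hb _ (mem_frontier_unitSq.2 ⟨⟨ht, by simp⟩, by simp⟩)) hp.1)
    ((Real.summable_abs_int_rpow (by norm_num)).mul_right _) (fun n => ?_) hp.2
  rcases eq_or_ne n 0 with rfl | hn
  · simp
  have hn0 : 0 < |(n:ℝ)| := by positivity
  have habs : |∫ z in (0:ℝ)..1, pdx ψ (x, z) * Real.sin (n * Real.pi * z)|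
      = |∫ z in (0:ℝ)..1, pdx ψ (x, z) * Real.sin (|(n:ℝ)| * Real.pi * z)| := by
    rcases abs_choice (n:ℝ) with h | h
    · rw [h]
    · rw [h]
      simp [Real.sin_neg]
  have hsin : Real.sin (|(n:ℝ)| * Real.pi) = 0 := by
    rw [← Int.cast_abs]
    exact Real.sin_int_mul_pi _
  have hmode := sq_sine_coeff_pdx_le hψ hb (mul_pos hn0 Real.pi_pos) hsin hp.1
  rw [habs]
  set I := ∫ z in (0:ℝ)..1, pdx ψ (x, z) * Real.sin (|(n:ℝ)| * Real.pi * z)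
  have hpi : |(n:ℝ)| ^ 3 ≤ (|(n:ℝ)| * Real.pi) ^ 3 :=
    pow_le_pow_left₀ hn0.le (le_mul_of_one_le_right hn0.le (by linarith [Real.pi_gt_three])) 3
  have hI : |(n:ℝ)| ^ 3 * I ^ 2 ≤ 8 * S :=
    (mul_le_mul_of_nonneg_right hpi (sq_nonneg _)).trans hmode
  have hpow : (|(n:ℝ)| ^ (-(3/2) : ℝ)) ^ 2 = (|(n:ℝ)| ^ 3)⁻¹ := by
    rw [← Real.rpow_natCast, ← Real.rpow_mul hn0.le, ← Real.rpow_natCast, ← Real.rpow_neg hn0.le]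
    norm_num
  refine abs_le_of_sq_le_sq' ?_ (by positivity) |> abs_le.2
  rw [mul_pow, hpow, Real.sq_sqrt ((by positivity : (0:ℝ) ≤ |(n:ℝ)| ^ 3 * I ^ 2).trans hI)]
  rw [inv_mul_eq_div, le_div_iff₀ (by positivity)]
  linarith

theorem abs_pdz_le {ψ : ℝ × ℝ → ℝ} (hψ : ContDiff ℝ (⊤ : ℕ∞) ψ)
    (hb : ∀ p ∈ frontier unitSq, ψ p = 0) {p : ℝ × ℝ} (hp : p ∈ unitSq) :
    |pdz ψ p| ≤ (∑' n : ℤ, |(n:ℝ)| ^ (-(3/2) : ℝ)) *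
      Real.sqrt (8 * ∫ p in unitSq, ((lap ψ p) ^ 2 + (pdx (lap ψ) p) ^ 2)) := by
  have hs : ContDiff ℝ (⊤ : ℕ∞) (ψ ∘ Prod.swap) := hψ.comp (contDiff_snd.prodMk contDiff_fst)
  have h := abs_pdx_le hs (fun q hq => hb q.swap (mem_frontier_unitSq.2 (by
    have := mem_frontier_unitSq.1 hq
    exact ⟨⟨this.1.2, this.1.1⟩, by simp only [Prod.fst_swap, Prod.snd_swap]; tauto⟩)))
    (p := p.swap) ⟨hp.2, hp.1⟩
  rw [pdx_comp_swap (hψ.differentiable (by simp)), lap_comp_swap hψ,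
    pdz_comp_swap (hψ.lap.differentiable (by simp))] at h
  rw [← setIntegral_unitSq_comp_swap]
  simpa using h

theorem sqrt_add_le_add_sqrt {a b : ℝ} (ha : 0 ≤ a) (hb : 0 ≤ b) :
    Real.sqrt (a + b) ≤ Real.sqrt a + Real.sqrt b := by
  refine Real.sqrt_le_iff.2 ⟨by positivity, ?_⟩
  rw [add_sq, Real.sq_sqrt ha, Real.sq_sqrt hb]
  nlinarith [mul_nonneg (Real.sqrt_nonneg a) (Real.sqrt_nonneg b)]

/-- Elliptic regularity plus Sobolev embedding: the sup norm of `∇ψ` on the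
unit square is controlled by `L²` norms of `Δψ` and `∇(Δψ)`, for `ψ` vanishing
on the boundary. -/
theorem gradient_sup_bound :
    ∃ c : ℝ, 0 < c ∧ ∀ ψ : ℝ × ℝ → ℝ, ContDiff ℝ (⊤ : ℕ∞) ψ →
      (∀ p ∈ frontier unitSq, ψ p = 0) →
      (⨆ p : unitSq, (|pdx ψ (p : ℝ × ℝ)| + |pdz ψ (p : ℝ × ℝ)|)) ≤
        c * (Real.sqrt (∫ p in unitSq, (lap ψ p) ^ 2) +
          Real.sqrt (∫ p in unitSq, ((pdx (lap ψ) p) ^ 2 + (pdz (lap ψ) p) ^ 2))) := by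
  set K := ∑' n : ℤ, |(n:ℝ)| ^ (-(3/2) : ℝ)
  have hK0 : 0 ≤ K := tsum_nonneg fun n => by positivity
  refine ⟨2 * (K * Real.sqrt 8) + 1, by positivity, fun ψ hψ hb => ?_⟩
  have : Nonempty unitSq := ⟨⟨(0, 0), by simp [unitSq]⟩⟩
  refine ciSup_le fun p => ?_
  have hint : ∀ {f : ℝ × ℝ → ℝ}, Continuous f → IntegrableOn f unitSq := fun hf =>
    hf.continuousOn.integrableOn_compact (isCompact_Icc.prod isCompact_Icc)
  have c3 := hψ.lap.continuous
  have c4 := hψ.lap.pdz.continuous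
  have c5 := hψ.lap.pdx.continuous
  set R := Real.sqrt (∫ p in unitSq, (lap ψ p) ^ 2) +
    Real.sqrt (∫ p in unitSq, ((pdx (lap ψ) p) ^ 2 + (pdz (lap ψ) p) ^ 2))
  have hR0 : 0 ≤ R := by positivity
  have key : ∀ g : ℝ × ℝ → ℝ, Continuous g →
      (∀ p, g p ^ 2 ≤ (pdx (lap ψ) p) ^ 2 + (pdz (lap ψ) p) ^ 2) →
      Real.sqrt (8 * ∫ p in unitSq, ((lap ψ p) ^ 2 + g p ^ 2)) ≤ Real.sqrt 8 * R := by
    intro g hg hle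
    rw [Real.sqrt_mul (by norm_num)]
    gcongr
    rw [integral_add (hint (by fun_prop)) (hint (by fun_prop))]
    refine (sqrt_add_le_add_sqrt (by positivity) (by positivity)).trans ?_
    exact add_le_add_right (Real.sqrt_le_sqrt
      (integral_mono (hint (by fun_prop)) (hint (by fun_prop)) hle)) _
  have h1 := (abs_pdx_le hψ hb p.2).trans (mul_le_mul_of_nonneg_left
    (key _ c4 fun q => by nlinarith [sq_nonneg (pdx (lap ψ) q)]) hK0)
  have h2 := (abs_pdz_le hψ hb p.2).trans (mul_le_mul_of_nonneg_left
    (key _ c5 fun q => by nlinarith [sq_nonneg (pdz (lap ψ) q)]) hK0)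
  calc _ ≤ 2 * (K * Real.sqrt 8) * R := by linarith
    _ ≤ _ := by nlinarith
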